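/- Let E be a Gysin functor on a finitary lextensive category C, and let X and Y be objects of C. Then every element α of C_E(X, Y) = E(Y × X) satisfies α = Rπ₁ ∘ Dα ∘ Iπ₂, where π₁ : Y × X → Y and π₂ : Y × X → X are the projections. In particular, every morphism in C_E can be written in the form Rf ∘ Da ∘ Ig for some object Z, morphisms f : Z → Y and g : Z → X in C, and a ∈ E(Z). -/

import Mathlib

open CategoryTheory CategoryTheory.Limits

universe v u

/-- A Gysin functor on a finitary lextensive category `C`. -/
structure GysinFunctor (C : Type u) [Category.{v} C] [HasFiniteLimits C]
    [HasFiniteCoproducts C] [FinitaryExtensive C] where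
  /-- The underlying rings. -/
  E : C → Type v
  commRing : ∀ X : C, CommRing (E X)
  /-- Contravariant functoriality (pullback), by ring maps. -/
  pull : ∀ {X Y : C}, (X ⟶ Y) → (E Y →+* E X)
  pull_id : ∀ X : C, pull (𝟙 X) = RingHom.id (E X)
  pull_comp : ∀ {X Y Z : C} (f : X ⟶ Y) (g : Y ⟶ Z),
    pull (f ≫ g) = (pull f).comp (pull g)
  /-- Covariant functoriality (pushforward/Gysin maps), by additive maps. -/
  push : ∀ {X Y : C}, (X ⟶ Y) → (E X →+ E Y)
  push_id : ∀ X : C, push (𝟙 X) = AddMonoidHom.id (E X)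
  push_comp : ∀ {X Y Z : C} (f : X ⟶ Y) (g : Y ⟶ Z),
    push (f ≫ g) = (push g).comp (push f)
  /-- Zero axiom: `E ∅ = 0`. -/
  zero : Subsingleton (E (⊥_ C))
  /-- Behavior on sums. -/
  coprod_bij : ∀ X Y : C, Function.Bijective
    (fun a : E (X ⨿ Y) => (pull coprod.inl a, pull coprod.inr a))
  /-- Push-product axiom. -/
  push_product : ∀ {X X' Y Y' : C} (f : X ⟶ X') (g : Y ⟶ Y') (a : E X) (b : E Y),
    push (prod.map f g) (pull prod.fst a * pull prod.snd b)
      = pull prod.fst (push f a) * pull prod.snd (push g b)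
  /-- Push-pull axiom. -/
  push_pull : ∀ {A B C' D' : C} (f : A ⟶ B) (p : A ⟶ C') (q : B ⟶ D') (g : C' ⟶ D'),
    IsPullback f p q g → ∀ a : E C', push f (pull p a) = pull q (push g a)

namespace GysinFunctor

attribute [instance] GysinFunctor.commRing

variable {C : Type u} [Category.{v} C] [HasFiniteLimits C]
  [HasFiniteCoproducts C] [FinitaryExtensive C] (G : GysinFunctor C)

/-- Hom-groups of the category of correspondences: `C_E(A, B) = E(B × A)`. -/
noncomputable def Hom (A B : C) : Type v := G.E (B ⨯ A)

noncomputable instance (A B : C) : AddCommGroup (G.Hom A B) :=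
  inferInstanceAs (AddCommGroup (G.E (B ⨯ A)))

/-- Composition in the category of correspondences. -/
noncomputable def comp {A B Cc : C} (β : G.Hom B Cc) (α : G.Hom A B) : G.Hom A Cc :=
  G.push (prod.map prod.fst (𝟙 A) : (Cc ⨯ B) ⨯ A ⟶ Cc ⨯ A)
    (G.pull (prod.fst : (Cc ⨯ B) ⨯ A ⟶ Cc ⨯ B) β *
      G.pull (prod.map prod.snd (𝟙 A) : (Cc ⨯ B) ⨯ A ⟶ B ⨯ A) α)

/-- The identity morphism `i_A = Δ_!(1)` in the category of correspondences. -/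
noncomputable def ident (A : C) : G.Hom A A := G.push (diag A) 1

/-- `Rf`, the forward map associated to `f : A ⟶ B`. -/
noncomputable def Rmor {A B : C} (f : A ⟶ B) : G.Hom A B :=
  G.push (prod.lift f (𝟙 A)) 1

/-- `If`, the transfer map associated to `f : A ⟶ B`. -/
noncomputable def Imor {A B : C} (f : A ⟶ B) : G.Hom B A :=
  G.push (prod.lift (𝟙 A) f) 1

/-- `Da`, the diagonal endomorphism associated to `a ∈ E(A)`. -/
noncomputable def Dmor {A : C} (a : G.E A) : G.Hom A A := G.push (diag A) a

/-- The duality anti-automorphism on hom-groups. -/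
noncomputable def star {A B : C} (α : G.Hom A B) : G.Hom B A :=
  G.pull (prod.braiding A B).hom α

end GysinFunctor

lemma isPullback_graph_diag {C : Type u} [Category.{v} C] [HasBinaryProducts C]
    {A B : C} (f : A ⟶ B) :
    IsPullback f (prod.lift (𝟙 A) f) (diag B) (prod.map f (𝟙 B)) := by
  refine ⟨⟨by ext <;> simp [prod.lift_fst, prod.lift_snd]⟩,
    ⟨PullbackCone.IsLimit.mk _ (fun s => s.snd ≫ prod.fst) ?_ ?_ ?_⟩⟩
  · intro s
    have h := s.condition =≫ prod.fst
    simpa [prod.lift_fst, prod.lift_snd] using h.symm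
  · intro s
    have h₁ := s.condition =≫ prod.fst
    have h₂ := s.condition =≫ prod.snd
    simp only [Category.assoc, prod.lift_fst, prod.lift_snd, prod.map_fst, prod.map_snd,
      Category.comp_id] at h₁ h₂
    ext
    · simp [prod.lift_fst]
    · simp [prod.lift_snd, ← h₁, h₂]
  · intro s m _ h
    simp [prod.lift_fst, ← h]

lemma isPullback_map_fst {C : Type u} [Category.{v} C] [HasBinaryProducts C]
    {B D A : C} (g : B ⟶ D) :
    IsPullback (prod.map g (𝟙 A)) prod.fst (prod.fst : D ⨯ A ⟶ D) g := by
  refine ⟨⟨by simp⟩, ⟨PullbackCone.IsLimit.mk _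
    (fun s => prod.lift s.snd (s.fst ≫ prod.snd)) ?_ ?_ ?_⟩⟩
  · intro s
    have h := s.condition
    ext <;> simp [prod.lift_fst, prod.lift_snd, h]
  · intro s
    simp [prod.lift_fst]
  · intro s m h₁ h₂
    ext
    · simp [prod.lift_fst, ← h₂]
    · simp [prod.lift_snd, ← h₁]

lemma isPullback_graph_snd {C : Type u} [Category.{v} C] [HasBinaryProducts C]
    {A B D : C} (g : B ⟶ A) :
    IsPullback (prod.lift (𝟙 (D ⨯ B)) (prod.snd ≫ g)) prod.snd
      (prod.map prod.snd (𝟙 A)) (prod.lift (𝟙 B) g) := by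
  refine ⟨⟨by ext <;> simp [prod.lift_fst, prod.lift_snd]⟩,
    ⟨PullbackCone.IsLimit.mk _ (fun s => s.fst ≫ prod.fst) ?_ ?_ ?_⟩⟩
  · intro s
    have h₁ := s.condition =≫ prod.fst
    have h₂ := s.condition =≫ prod.snd
    simp only [Category.assoc, prod.lift_fst, prod.lift_snd, prod.map_fst, prod.map_snd,
      Category.comp_id] at h₁ h₂
    rw [← h₁] at h₂
    simp only [Category.assoc] at h₂
    ext <;> simp [prod.lift_fst, prod.lift_snd, h₂]
  · intro s
    have h₁ := s.condition =≫ prod.fst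
    simpa [prod.lift_fst, prod.lift_snd] using h₁
  · intro s m h₁ _
    simp [prod.lift_fst, ← h₁]

namespace GysinFunctor

variable {C : Type u} [Category.{v} C] [HasFiniteLimits C]
  [HasFiniteCoproducts C] [FinitaryExtensive C] (G : GysinFunctor C)

lemma pull_pull {X Y Z : C} (f : X ⟶ Y) (g : Y ⟶ Z) (a : G.E Z) :
    G.pull f (G.pull g a) = G.pull (f ≫ g) a := by
  rw [G.pull_comp, RingHom.comp_apply]

lemma push_push {X Y Z : C} (f : X ⟶ Y) (g : Y ⟶ Z) (a : G.E X) :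
    G.push g (G.push f a) = G.push (f ≫ g) a := by
  rw [G.push_comp, AddMonoidHom.comp_apply]

lemma pull_id_apply {X : C} (a : G.E X) : G.pull (𝟙 X) a = a := by
  rw [G.pull_id, RingHom.id_apply]

lemma push_id_apply {X : C} (a : G.E X) : G.push (𝟙 X) a = a := by
  rw [G.push_id, AddMonoidHom.id_apply]

/-- The projection formula `f_!(a) b = f_!(a f^*(b))`. -/
lemma push_mul {A B : C} (f : A ⟶ B) (a : G.E A) (b : G.E B) :
    G.push f a * b = G.push f (a * G.pull f b) := by
  have h := G.push_pull _ _ _ _ (isPullback_graph_diag f)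
    (G.pull prod.fst a * G.pull prod.snd b)
  rw [G.push_product] at h
  simpa [prod.lift_fst, prod.lift_snd, pull_pull, pull_id_apply, push_id_apply] using h.symm

lemma Rmor_comp {A B D : C} (f : B ⟶ D) (α : G.E (B ⨯ A)) :
    G.comp (G.Rmor f) (α : G.Hom A B) = G.push (prod.map f (𝟙 A)) α := by
  have h₁ : prod.map (prod.lift f (𝟙 B)) (𝟙 A) ≫ prod.map prod.snd (𝟙 A) = 𝟙 (B ⨯ A) := by
    simp [prod.lift_snd]
  have h₂ : prod.map (prod.lift f (𝟙 B)) (𝟙 A) ≫ prod.map prod.fst (𝟙 A) =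
      prod.map f (𝟙 A) := by
    simp [prod.lift_fst]
  unfold comp Rmor
  rw [← G.push_pull _ _ _ _ (isPullback_map_fst (A := A) (prod.lift f (𝟙 B))), map_one,
    push_mul, one_mul, pull_pull, push_push, h₁, h₂, pull_id_apply]

lemma comp_Imor {A B D : C} (β : G.E (D ⨯ B)) (g : B ⟶ A) :
    G.comp (β : G.Hom B D) (G.Imor g) = G.push (prod.map (𝟙 D) g) β := by
  have h : prod.lift (𝟙 (D ⨯ B)) (prod.snd ≫ g) ≫ prod.map prod.fst (𝟙 A) =
      prod.map (𝟙 D) g := by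
    ext <;> simp [prod.lift_fst, prod.lift_snd]
  unfold comp Imor
  rw [← G.push_pull _ _ _ _ (isPullback_graph_snd (D := D) g), map_one, mul_comm,
    push_mul, one_mul, pull_pull, push_push, h, prod.lift_fst, pull_id_apply]

lemma eq_Rmor_comp_Dmor_comp_Imor {X Y : C} (α : G.E (Y ⨯ X)) :
    α = G.comp (G.Rmor (prod.fst : Y ⨯ X ⟶ Y))
      (G.comp (G.Dmor α) (G.Imor (prod.snd : Y ⨯ X ⟶ X))) := by
  have h : diag (Y ⨯ X) ≫ prod.map (𝟙 (Y ⨯ X)) prod.snd ≫ prod.map prod.fst (𝟙 X) =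
      𝟙 (Y ⨯ X) := by
    ext <;> simp
  have h₁ := G.comp_Imor (G.Dmor α) (prod.snd : Y ⨯ X ⟶ X)
  refine .symm ((congrArg (G.comp _) h₁).trans ((G.Rmor_comp _ _).trans ?_))
  rw [Dmor, push_push, push_push, h, push_id_apply]

end GysinFunctor

open GysinFunctor in
/-- Every morphism in `C_E` can be written in the form `Rf ∘ Da ∘ Ig`; explicitly,
`α = Rπ₁ ∘ Dα ∘ Iπ₂` for `α ∈ C_E(X, Y) = E(Y × X)`. -/
theorem gysinFunctor_RDI_form
    {C : Type u} [Category.{v} C] [HasFiniteLimits C]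
    [HasFiniteCoproducts C] [FinitaryExtensive C] (G : GysinFunctor C)
    (X Y : C) (α : G.Hom X Y) :
    α = G.comp (G.Rmor (prod.fst : Y ⨯ X ⟶ Y))
          (G.comp (G.Dmor (α : G.E (Y ⨯ X))) (G.Imor (prod.snd : Y ⨯ X ⟶ X))) ∧
    ∃ (Z : C) (f : Z ⟶ Y) (g : Z ⟶ X) (a : G.E Z),
      α = G.comp (G.Rmor f) (G.comp (G.Dmor a) (G.Imor g)) :=
  ⟨G.eq_Rmor_comp_Dmor_comp_Imor α, Y ⨯ X, prod.fst, prod.snd, α,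
    G.eq_Rmor_comp_Dmor_comp_Imor α⟩
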